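/- arXiv:1812.03052 — 2 statements merged into one kernel-verified Lean document; each statement's English description precedes it below -/
import Mathlib

section
/- Let A : Matrix I J ℂ and B : Matrix K J ℂ, let X be the Moore–Penrose inverse of A and Y the Moore–Penrose inverse of B. Then: (a) R(Bᴴ) ⊆ R(Aᴴ) if and only if B * X * A = B; (b) R(Aᴴ) = R(Bᴴ) if and only if X * A = Y * B; (c) for any C : Matrix L J ℂ with Moore–Penrose inverse Z of B, and any A' : Matrix I J ℂ, one has R(A' * Y) = R(A' * Bᴴ). -/
open Matrix

/-- `X` is a Moore–Penrose inverse of `A`. -/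
def IsMPInv {I J : Type*} [Fintype I] [Fintype J]
    (A : Matrix I J ℂ) (X : Matrix J I ℂ) : Prop :=
  A * X * A = A ∧ X * A * X = X ∧ (A * X)ᴴ = A * X ∧ (X * A)ᴴ = X * A

theorem range_mulVec_mul_subset {I J K : Type*} [Fintype J] [Fintype K]
    (M : Matrix I J ℂ) (N : Matrix J K ℂ) :
    Set.range (M * N).mulVec ⊆ Set.range M.mulVec := by
  rintro _ ⟨v, rfl⟩
  exact ⟨N *ᵥ v, mulVec_mulVec v M N⟩

namespace IsMPInv

variable {I J K : Type*} [Fintype I] [Fintype J] [Fintype K]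
  {A : Matrix I J ℂ} {X : Matrix J I ℂ}

theorem mul_mul_conjTranspose (h : IsMPInv A X) : X * A * Aᴴ = Aᴴ := by
  rw [← h.2.2.2, ← conjTranspose_mul, ← Matrix.mul_assoc, h.1]

theorem conjTranspose_mul_conjTranspose (h : IsMPInv A X) : Aᴴ * Xᴴ = X * A := by
  rw [← conjTranspose_mul, h.2.2.2]

theorem range_conjTranspose_subset_iff (h : IsMPInv A X) (B : Matrix K J ℂ) :
    Set.range Bᴴ.mulVec ⊆ Set.range Aᴴ.mulVec ↔ B * X * A = B := by
  constructor
  · intro hBA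
    have hB : X * A * Bᴴ = Bᴴ := by
      classical
      refine ext_of_mulVec_single fun k => ?_
      obtain ⟨w, hw⟩ := hBA ⟨Pi.single k 1, rfl⟩
      rw [← mulVec_mulVec, ← hw, mulVec_mulVec, h.mul_mul_conjTranspose]
    have hB' := congrArg conjTranspose hB
    rwa [conjTranspose_mul, h.2.2.2, conjTranspose_conjTranspose, ← Matrix.mul_assoc] at hB'
  · intro hB
    have hB' : Bᴴ = Aᴴ * (Xᴴ * Bᴴ) := by
      rw [← conjTranspose_mul, ← conjTranspose_mul, hB]
    rw [hB']
    exact range_mulVec_mul_subset _ _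

end IsMPInv

theorem row_range_identities
    {I J K : Type*} [Fintype I] [Fintype J] [Fintype K]
    (A : Matrix I J ℂ) (B : Matrix K J ℂ)
    (X : Matrix J I ℂ) (hX : IsMPInv A X)
    (Y : Matrix J K ℂ) (hY : IsMPInv B Y) :
    (Set.range Bᴴ.mulVec ⊆ Set.range Aᴴ.mulVec ↔ B * X * A = B) ∧
    (Set.range Aᴴ.mulVec = Set.range Bᴴ.mulVec ↔ X * A = Y * B) ∧
    (∀ A' : Matrix I J ℂ,
      Set.range (A' * Y).mulVec = Set.range (A' * Bᴴ).mulVec) := by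
  refine ⟨hX.range_conjTranspose_subset_iff B, ?_, fun A' => ?_⟩
  · rw [Set.Subset.antisymm_iff, hY.range_conjTranspose_subset_iff A,
      hX.range_conjTranspose_subset_iff B]
    constructor
    · rintro ⟨hA, hB⟩
      calc X * A = (X * A)ᴴ := hX.2.2.2.symm
        _ = (X * A * (Y * B))ᴴ := by
          rw [Matrix.mul_assoc X, ← Matrix.mul_assoc A, hA]
        _ = Y * (B * X * A) := by
          rw [conjTranspose_mul, hX.2.2.2, hY.2.2.2]
          simp only [Matrix.mul_assoc]
        _ = Y * B := by rw [hB]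
    · intro hXY
      constructor
      · rw [Matrix.mul_assoc, ← hXY, ← Matrix.mul_assoc, hX.1]
      · rw [Matrix.mul_assoc, hXY, ← Matrix.mul_assoc, hY.1]
  · apply Set.Subset.antisymm
    · have h : A' * Y = A' * Bᴴ * (Yᴴ * Y) := by
        rw [Matrix.mul_assoc, ← Matrix.mul_assoc Bᴴ, hY.conjTranspose_mul_conjTranspose, hY.2.1]
      rw [h]
      exact range_mulVec_mul_subset _ _
    · have h : A' * Bᴴ = A' * Y * (B * Bᴴ) := by
        rw [Matrix.mul_assoc, ← Matrix.mul_assoc Y, hY.mul_mul_conjTranspose]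
      rw [h]
      exact range_mulVec_mul_subset _ _
end

section
/- Let A : Matrix I J ℂ and B : Matrix J K ℂ, and let M : Matrix I I ℂ, N : Matrix K K ℂ, and P : Matrix J J ℂ be Hermitian positive definite. Define the weighted conjugate transposes A# := P⁻¹ * Aᴴ * M : Matrix J I ℂ and B# := N⁻¹ * Bᴴ * P : Matrix K J ℂ. Let XA be the weighted Moore–Penrose inverse of A with respect to (M, P), XB the weighted Moore–Penrose inverse of B with respect to (P, N), and Z the weighted Moore–Penrose inverse of A * B with respect to (M, N). Then Z = XB * XA if and only if R(A# * A * B) ⊆ R(B) and R(B * B# * A#) ⊆ R(A#). -/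
open Matrix
open scoped ComplexOrder

/-- `X` is a weighted Moore–Penrose inverse of `A` with respect to weights `M` and `N`. -/
def IsWMPInv {I J : Type*} [Fintype I] [Fintype J]
    (M : Matrix I I ℂ) (N : Matrix J J ℂ)
    (A : Matrix I J ℂ) (X : Matrix J I ℂ) : Prop :=
  A * X * A = A ∧ X * A * X = X ∧
  (M * A * X)ᴴ = M * A * X ∧ (N * X * A)ᴴ = N * X * A

theorem commute_of_mul_mul_eq_mul_mul {R : Type*} [Semigroup R] {p q E : R} (hc : Commute p q)
    (hEq : E * q = E) (hqE : q * E = E) (h : E * (p * q) = q * (p * E)) : Commute p E := by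
  rw [hc.eq, ← mul_assoc, hEq, ← mul_assoc, ← hc.eq, mul_assoc, hqE] at h
  exact h.symm

/-- The weighted adjoint of `A`: its adjoint for the inner products with Gram matrices
`N` on the source and `M` on the target. -/
noncomputable def wadj {I J : Type*} [Fintype I] [Fintype J] [DecidableEq J]
    (M : Matrix I I ℂ) (N : Matrix J J ℂ) (A : Matrix I J ℂ) : Matrix J I ℂ :=
  N⁻¹ * Aᴴ * M

section WeightedAdjoint

variable {I J K : Type*} [Fintype I] [Fintype J] [Fintype K]
  {M : Matrix I I ℂ} {N : Matrix K K ℂ} {P : Matrix J J ℂ}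

theorem Matrix.PosDef.isUnit_det_complex [DecidableEq I] (hM : M.PosDef) : IsUnit M.det :=
  (Matrix.isUnit_iff_isUnit_det M).1 hM.isUnit

theorem wadj_mul [DecidableEq J] [DecidableEq K]
    (hP : P.PosDef) (A : Matrix I J ℂ) (B : Matrix J K ℂ) :
    wadj M N (A * B) = wadj P N B * wadj M P A := by
  simp only [wadj, conjTranspose_mul, Matrix.mul_assoc,
    Matrix.mul_nonsing_inv_cancel_left _ _ hP.isUnit_det_complex]

theorem wadj_wadj [DecidableEq I] [DecidableEq J]
    (hM : M.PosDef) (hP : P.PosDef) (A : Matrix I J ℂ) :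
    wadj P M (wadj M P A) = A := by
  simp only [wadj, conjTranspose_mul, conjTranspose_nonsing_inv, conjTranspose_conjTranspose,
    hM.isHermitian.eq, hP.isHermitian.eq, Matrix.mul_assoc,
    Matrix.nonsing_inv_mul _ hP.isUnit_det_complex, Matrix.mul_one,
    Matrix.nonsing_inv_mul_cancel_left _ _ hM.isUnit_det_complex]

theorem wadj_sub [DecidableEq J]
    (A B : Matrix I J ℂ) : wadj M P (A - B) = wadj M P A - wadj M P B := by
  simp only [wadj, conjTranspose_sub, Matrix.mul_sub, Matrix.sub_mul]

theorem wadj_eq_self_iff [DecidableEq I] (hM : M.PosDef) (A : Matrix I I ℂ) :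
    wadj M M A = A ↔ (M * A)ᴴ = M * A := by
  rw [wadj, conjTranspose_mul, hM.isHermitian.eq]
  constructor
  · intro h
    rw [← Matrix.mul_nonsing_inv_cancel_left M (Aᴴ * M) hM.isUnit_det_complex, ← Matrix.mul_assoc M⁻¹, h]
  · intro h
    rw [Matrix.mul_assoc, h, Matrix.nonsing_inv_mul_cancel_left _ _ hM.isUnit_det_complex]

theorem eq_zero_of_wadj_mul_self [DecidableEq J] (hM : M.PosDef) (hP : P.PosDef) {A : Matrix I J ℂ}
    (h : wadj M P A * A = 0) : A = 0 := by
  have h' : Aᴴ * M * A = 0 := by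
    rw [← Matrix.mul_nonsing_inv_cancel_left P (Aᴴ * M * A) hP.isUnit_det_complex]
    simp only [wadj, Matrix.mul_assoc] at h ⊢
    rw [h, Matrix.mul_zero]
  refine Matrix.ext_of_mulVec_single fun j => ?_
  rw [Matrix.zero_mulVec]
  by_contra hv
  have hpos := hM.dotProduct_mulVec_pos hv
  rw [Matrix.star_mulVec, ← Matrix.dotProduct_mulVec, Matrix.mulVec_mulVec, Matrix.mulVec_mulVec,
    h', Matrix.zero_mulVec, dotProduct_zero] at hpos
  exact lt_irrefl _ hpos

theorem isWMPInv_iff [DecidableEq I] [DecidableEq J]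
    (hM : M.PosDef) (hP : P.PosDef) {A : Matrix I J ℂ} {X : Matrix J I ℂ} :
    IsWMPInv M P A X ↔ A * X * A = A ∧ X * A * X = X ∧
      wadj P M X * wadj M P A = A * X ∧ wadj M P A * wadj P M X = X * A := by
  rw [← wadj_mul hP, ← wadj_mul hM, wadj_eq_self_iff hM, wadj_eq_self_iff hP, IsWMPInv,
    Matrix.mul_assoc M, Matrix.mul_assoc P]

theorem IsWMPInv.unique [DecidableEq I] [DecidableEq J]
    (hM : M.PosDef) (hP : P.PosDef) {A : Matrix I J ℂ} {X Y : Matrix J I ℂ}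
    (hX : IsWMPInv M P A X) (hY : IsWMPInv M P A Y) : X = Y := by
  obtain ⟨x1, x2, x3, x4⟩ := (isWMPInv_iff hM hP).1 hX
  obtain ⟨y1, y2, y3, y4⟩ := (isWMPInv_iff hM hP).1 hY
  have hl : A * X = A * Y := by
    have h := congrArg (wadj M P) y1
    rw [Matrix.mul_assoc, wadj_mul hP, wadj_mul hM, y4] at h
    calc A * X = wadj P M X * wadj M P A := x3.symm
      _ = wadj P M X * (wadj M P A * wadj P M Y * wadj M P A) := by rw [y4, h]
      _ = (wadj P M X * wadj M P A) * (wadj P M Y * wadj M P A) := by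
        simp only [Matrix.mul_assoc]
      _ = (A * X * A) * Y := by rw [x3, y3]; simp only [Matrix.mul_assoc]
      _ = A * Y := by rw [x1]
  have hr : X * A = Y * A := by
    have h := congrArg (wadj M P) x1
    rw [Matrix.mul_assoc, wadj_mul hP, wadj_mul hM, x4] at h
    have h' := congrArg (wadj M P) y1
    rw [Matrix.mul_assoc, wadj_mul hP, wadj_mul hM, y4] at h'
    calc X * A = wadj M P A * wadj P M X := x4.symm
      _ = (Y * A * wadj M P A) * wadj P M X := by rw [h']
      _ = Y * A * (wadj M P A * wadj P M X) := by simp only [Matrix.mul_assoc]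
      _ = Y * (A * X * A) := by rw [x4]; simp only [Matrix.mul_assoc]
      _ = Y * A := by rw [x1]
  calc X = X * A * X := x2.symm
    _ = Y * (A * X) := by rw [hr, Matrix.mul_assoc]
    _ = Y := by rw [hl, ← Matrix.mul_assoc, y2]

/-- Idempotents, self-adjoint for a weighted inner product, commute if their product is
idempotent. -/
theorem commute_of_isIdempotentElem_mul [DecidableEq J] (hP : P.PosDef) {p q : Matrix J J ℂ}
    (hp : wadj P P p = p) (hq : wadj P P q = q) (hpp : p * p = p) (hqq : q * q = q)
    (h : q * p * (q * p) = q * p) : Commute p q := by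
  have hd : wadj P P (q * p - p * q * p) = p * q - p * q * p := by
    rw [wadj_sub, wadj_mul hP, wadj_mul hP, wadj_mul hP, hp, hq, Matrix.mul_assoc p q p]
  have h0 : q * p - p * q * p = 0 := by
    apply eq_zero_of_wadj_mul_self hP hP
    rw [hd]
    have hp' (C : Matrix J J ℂ) : p * (p * C) = p * C := by rw [← Matrix.mul_assoc, hpp]
    have hq' (C : Matrix J J ℂ) : q * (q * C) = q * C := by rw [← Matrix.mul_assoc, hqq]
    simp only [Matrix.mul_assoc] at h
    simp only [Matrix.mul_sub, Matrix.sub_mul, Matrix.mul_assoc, hp', hq', h, sub_self]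
  have h1 := congrArg (wadj P P) (sub_eq_zero.1 h0)
  rw [wadj_mul hP, wadj_mul hP, wadj_mul hP, hp, hq, ← Matrix.mul_assoc] at h1
  exact h1.trans (sub_eq_zero.1 h0).symm

theorem commute_of_mul_mul_eq [DecidableEq J] (hP : P.PosDef) {p E : Matrix J J ℂ}
    (hp : wadj P P p = p) (hE : wadj P P E = E) (h : p * (E * p) = E * p) : Commute p E := by
  have h1 := congrArg (wadj P P) h
  rw [wadj_mul hP, wadj_mul hP, hp, hE, Matrix.mul_assoc, h] at h1
  exact h1.symm

theorem range_mulVec_subset_iff [DecidableEq I]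
    {B : Matrix J K ℂ} {Y : Matrix K J ℂ} {C : Matrix J I ℂ}
    (hY : B * Y * B = B) :
    Set.range C.mulVec ⊆ Set.range B.mulVec ↔ B * Y * C = C := by
  constructor
  · intro h
    refine Matrix.ext_of_mulVec_single fun j => ?_
    obtain ⟨w, hw⟩ := h ⟨Pi.single j 1, rfl⟩
    rw [← Matrix.mulVec_mulVec, ← hw, Matrix.mulVec_mulVec, hY]
  · rintro h _ ⟨v, rfl⟩
    exact ⟨(Y * C).mulVec v, by rw [Matrix.mulVec_mulVec, ← Matrix.mul_assoc, h]⟩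

/-- Reverse order law, with the range conditions replaced by commutation relations. -/
theorem isWMPInv_mul_iff_commute [DecidableEq I] [DecidableEq J] [DecidableEq K]
    (hM : M.PosDef) (hN : N.PosDef) (hP : P.PosDef)
    {A : Matrix I J ℂ} {B : Matrix J K ℂ} {XA : Matrix J I ℂ} {XB : Matrix K J ℂ}
    (hXA : IsWMPInv M P A XA) (hXB : IsWMPInv P N B XB) :
    IsWMPInv M N (A * B) (XB * XA) ↔
      Commute (B * XB) (wadj M P A * A) ∧ Commute (XA * A) (B * wadj P N B) := by
  obtain ⟨a1, a2, a3, a4⟩ := (isWMPInv_iff hM hP).1 hXA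
  obtain ⟨b1, b2, b3, b4⟩ := (isWMPInv_iff hP hN).1 hXB
  rw [isWMPInv_iff hM hN, wadj_mul hP, wadj_mul hP]
  have a5 : XA * A * wadj M P A = wadj M P A := by
    have h := congrArg (wadj M P) a1
    rwa [Matrix.mul_assoc, wadj_mul hP, wadj_mul hM, a4] at h
  have a6 : wadj M P A * (A * XA) = wadj M P A := by
    rw [← a3, ← Matrix.mul_assoc, a4, a5]
  have b5 : XB * B * wadj P N B = wadj P N B := by
    have h := congrArg (wadj P N) b1
    rwa [Matrix.mul_assoc, wadj_mul hN, wadj_mul hP, b4] at h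
  have b6 : wadj P N B * (B * XB) = wadj P N B := by
    rw [← b3, ← Matrix.mul_assoc, b4, b5]
  have hp : wadj P P (B * XB) = B * XB := by rw [wadj_mul hN, b3]
  have hq : wadj P P (XA * A) = XA * A := by rw [wadj_mul hM, a4]
  have hpp : (B * XB) * (B * XB) = B * XB := by rw [← Matrix.mul_assoc, b1]
  have hqq : (XA * A) * (XA * A) = XA * A := by rw [← Matrix.mul_assoc, a2]
  generalize hS : wadj M P A = S at *
  generalize hT : wadj P N B = T at *
  generalize hU : wadj P M XA = U at *
  generalize hV : wadj N P XB = V at *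
  have hqE : (XA * A) * (S * A) = S * A := by rw [← Matrix.mul_assoc, a5]
  have hEq : (S * A) * (XA * A) = S * A := by
    rw [Matrix.mul_assoc, ← Matrix.mul_assoc A, a1]
  have hpF : (B * XB) * (B * T) = B * T := by rw [← Matrix.mul_assoc, b1]
  have hFp : (B * T) * (B * XB) = B * T := by rw [Matrix.mul_assoc, b6]
  have hEG : (S * A) * (XA * U) = XA * A := by
    rw [Matrix.mul_assoc, ← Matrix.mul_assoc A, ← Matrix.mul_assoc, a6, a4]
  constructor
  · rintro ⟨h1, -, h3, h4⟩
    have hc : Commute (B * XB) (XA * A) := by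
      refine commute_of_isIdempotentElem_mul hP hp hq hpp hqq ?_
      have h := congrArg (fun C => XA * C * XB) h1
      simpa only [Matrix.mul_assoc] using h
    have hE : (S * A) * ((B * XB) * (XA * A)) = (XA * A) * ((B * XB) * (S * A)) :=
      calc (S * A) * ((B * XB) * (XA * A)) = S * (A * B * (XB * XA)) * A := by
            simp only [Matrix.mul_assoc]
        _ = S * (U * V * (T * S)) * A := by rw [h3]
        _ = (S * U) * ((V * T) * (S * A)) := by simp only [Matrix.mul_assoc]
        _ = (XA * A) * ((B * XB) * (S * A)) := by rw [a4, b3]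
    have hF : (B * T) * ((XA * A) * (B * XB)) = (B * XB) * ((XA * A) * (B * T)) :=
      calc (B * T) * ((XA * A) * (B * XB)) = (B * T) * ((S * U) * (V * T)) := by rw [a4, b3]
        _ = B * (T * S * (U * V)) * T := by simp only [Matrix.mul_assoc]
        _ = B * (XB * XA * (A * B)) * T := by rw [h4]
        _ = (B * XB) * ((XA * A) * (B * T)) := by simp only [Matrix.mul_assoc]
    constructor
    · exact commute_of_mul_mul_eq_mul_mul hc hEq hqE hE
    · exact commute_of_mul_mul_eq_mul_mul hc.symm hFp hpF hF
  · rintro ⟨hE, hF⟩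
    have hc : Commute (B * XB) (XA * A) := by
      have h : (B * XB) * (XA * A) = (S * A) * ((B * XB) * (XA * U)) := by
        rw [← hEG, ← Matrix.mul_assoc, hE.eq, Matrix.mul_assoc]
      refine (commute_of_mul_mul_eq hP hq hp ?_).symm
      rw [h, ← Matrix.mul_assoc, hqE]
    refine ⟨?_, ?_, ?_, ?_⟩
    · calc A * B * (XB * XA) * (A * B) = A * ((B * XB) * (XA * A)) * B := by
            simp only [Matrix.mul_assoc]
        _ = (A * XA * A) * (B * XB * B) := by rw [hc.eq]; simp only [Matrix.mul_assoc]
        _ = A * B := by rw [a1, b1]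
    · calc XB * XA * (A * B) * (XB * XA) = XB * ((XA * A) * (B * XB)) * XA := by
            simp only [Matrix.mul_assoc]
        _ = (XB * B * XB) * (XA * A * XA) := by rw [← hc.eq]; simp only [Matrix.mul_assoc]
        _ = XB * XA := by rw [a2, b2]
    · calc U * V * (T * S) = U * (V * T) * S := by simp only [Matrix.mul_assoc]
        _ = U * (B * XB) * (S * (A * XA)) := by rw [b3, a6]
        _ = U * ((B * XB) * (S * A)) * XA := by simp only [Matrix.mul_assoc]
        _ = (U * S) * (A * (B * XB)) * XA := by rw [hE.eq]; simp only [Matrix.mul_assoc]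
        _ = (A * XA * A) * (B * XB) * XA := by rw [a3]; simp only [Matrix.mul_assoc]
        _ = A * B * (XB * XA) := by rw [a1]; simp only [Matrix.mul_assoc]
    · calc T * S * (U * V) = T * (S * U) * V := by simp only [Matrix.mul_assoc]
        _ = (XB * B * T) * (XA * A) * V := by rw [a4, b5]
        _ = XB * ((B * T) * (XA * A)) * V := by simp only [Matrix.mul_assoc]
        _ = XB * (XA * A) * (B * (T * V)) := by rw [← hF.eq]; simp only [Matrix.mul_assoc]
        _ = XB * (XA * A) * (B * XB * B) := by rw [b4]; simp only [Matrix.mul_assoc]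
        _ = XB * XA * (A * B) := by rw [b1]; simp only [Matrix.mul_assoc]

end WeightedAdjoint

theorem wmp_reverse_order_iff
    {I J K : Type*} [Fintype I] [Fintype J] [Fintype K]
    [DecidableEq J] [DecidableEq K]
    (A : Matrix I J ℂ) (B : Matrix J K ℂ)
    (M : Matrix I I ℂ) (N : Matrix K K ℂ) (P : Matrix J J ℂ)
    (hMh : Mᴴ = M) (hM : M.PosDef) (hNh : Nᴴ = N) (hN : N.PosDef)
    (hPh : Pᴴ = P) (hP : P.PosDef)
    (XA : Matrix J I ℂ) (hXA : IsWMPInv M P A XA)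
    (XB : Matrix K J ℂ) (hXB : IsWMPInv P N B XB)
    (Z : Matrix K I ℂ) (hZ : IsWMPInv M N (A * B) Z) :
    Z = XB * XA ↔
      Set.range ((P⁻¹ * Aᴴ * M) * A * B).mulVec ⊆ Set.range B.mulVec ∧
      Set.range (B * (N⁻¹ * Bᴴ * P) * (P⁻¹ * Aᴴ * M)).mulVec ⊆
        Set.range (P⁻¹ * Aᴴ * M).mulVec := by
  classical
  obtain ⟨a1, a2, a3, a4⟩ := (isWMPInv_iff hM hP).1 hXA
  obtain ⟨b1, b2, b3, b4⟩ := (isWMPInv_iff hP hN).1 hXB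
  have hS : wadj M P A * wadj P M XA * wadj M P A = wadj M P A := by
    rw [← wadj_mul hM, ← wadj_mul hP, ← Matrix.mul_assoc, a1]
  have hp : wadj P P (B * XB) = B * XB := by rw [wadj_mul hN, b3]
  have hq : wadj P P (XA * A) = XA * A := by rw [wadj_mul hM, a4]
  have hE : wadj P P (wadj M P A * A) = wadj M P A * A := by
    rw [wadj_mul hM, wadj_wadj hM hP]
  have hF : wadj P P (B * wadj P N B) = B * wadj P N B := by
    rw [wadj_mul hN, wadj_wadj hP hN]
  have hZ_iff : Z = XB * XA ↔ IsWMPInv M N (A * B) (XB * XA) :=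
    ⟨fun h => h ▸ hZ, fun h => hZ.unique hM hN h⟩
  change _ ↔ Set.range (wadj M P A * A * B).mulVec ⊆ _ ∧
    Set.range (B * wadj P N B * wadj M P A).mulVec ⊆ Set.range (wadj M P A).mulVec
  rw [hZ_iff, isWMPInv_mul_iff_commute hM hN hP hXA hXB, range_mulVec_subset_iff b1,
    range_mulVec_subset_iff hS, a4]
  have hS' : XA * A * wadj M P A = wadj M P A := by rw [← a4, hS]
  refine and_congr ⟨fun h => ?_, fun h => ?_⟩ ⟨fun h => ?_, fun h => ?_⟩
  · rw [← Matrix.mul_assoc, h.eq, Matrix.mul_assoc, b1]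
  · refine commute_of_mul_mul_eq hP hp hE ?_
    simpa only [Matrix.mul_assoc] using congrArg (· * XB) h
  · rw [← Matrix.mul_assoc, h.eq, Matrix.mul_assoc, hS']
  · refine commute_of_mul_mul_eq hP hq hF ?_
    rw [← a4]
    rw [← a4] at h
    simpa only [Matrix.mul_assoc] using congrArg (· * wadj P M XA) h
end
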